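/- arXiv:2103.14094 — 2 statements merged into one kernel-verified Lean document; each statement's English description precedes it below -/
import Mathlib

section
/- Let x*, s, x, x̂ ∈ ℝ^m with Aᵀ(Ax* − b) = 0, let θ ∈ ℝ, set z = (1−θ)s + θx, and let s⁺(I) = z + θ·U_I P (x̂ − x). Then E_{I∼Π}[ h(s⁺(I)) ] − h(x*) = θ·⟨∇h(z), x̂ − x*⟩ + (1−θ)²·(h(s) − h(x*)) − θ²·(h(x) − h(x*)) + (θ²/2)·‖x̂ − x‖²_Σ. -/
open Matrix

/-- `h(x) = (1/2)‖Ax − b‖²` written with the dot product. -/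
noncomputable def quadH {m q : ℕ} (A : Matrix (Fin q) (Fin m) ℝ) (b : Fin q → ℝ)
    (x : Fin m → ℝ) : ℝ := (1 / 2) * ((A *ᵥ x - b) ⬝ᵥ (A *ᵥ x - b))

/-- `∇h(x) = Aᵀ(Ax − b)`. -/
noncomputable def gradH {m q : ℕ} (A : Matrix (Fin q) (Fin m) ℝ) (b : Fin q → ℝ)
    (x : Fin m → ℝ) : Fin m → ℝ := Aᵀ *ᵥ (A *ᵥ x - b)

/-- `‖x‖_M² = ⟨Mx, x⟩`. -/
noncomputable def mNormSq {m : ℕ} (M : Matrix (Fin m) (Fin m) ℝ) (x : Fin m → ℝ) : ℝ :=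
  (M *ᵥ x) ⬝ᵥ x

/-- `U_I = Σ_{i∈I} U_i`: the 0/1 diagonal matrix selecting the blocks in `I`. -/
def blockUSet {m d : ℕ} (blk : Fin m → Fin d) (I : Finset (Fin d)) :
    Matrix (Fin m) (Fin m) ℝ :=
  Matrix.diagonal (fun j => if blk j ∈ I then 1 else 0)

/-- `p_i = Prob_{I∼Π}(i ∈ I)`. -/
noncomputable def pblock {d : ℕ} (Pi : Finset (Fin d) → ℝ) (i : Fin d) : ℝ :=
  ∑ I ∈ Finset.univ.filter (fun I : Finset (Fin d) => i ∈ I), Pi I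

/-- `P = diag(p_1⁻¹ Id_{m_1},…,p_d⁻¹ Id_{m_d})`. -/
noncomputable def Pmat {m d : ℕ} (blk : Fin m → Fin d) (Pi : Finset (Fin d) → ℝ) :
    Matrix (Fin m) (Fin m) ℝ :=
  Matrix.diagonal (fun j => (pblock Pi (blk j))⁻¹)

/-- `Σ = E_{I∼Π}[U_I P AᵀA P U_I]`. -/
noncomputable def SigmaMat {m q d : ℕ} (A : Matrix (Fin q) (Fin m) ℝ)
    (blk : Fin m → Fin d) (Pi : Finset (Fin d) → ℝ) : Matrix (Fin m) (Fin m) ℝ :=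
  ∑ I : Finset (Fin d),
    Pi I • (blockUSet blk I * Pmat blk Pi * (Aᵀ * A) * Pmat blk Pi * blockUSet blk I)

/-- The second-order expansion of `quadH` is exact. -/
theorem quadH_add {m q : ℕ} (A : Matrix (Fin q) (Fin m) ℝ) (b : Fin q → ℝ)
    (u v : Fin m → ℝ) :
    quadH A b (u + v)
      = quadH A b u + gradH A b u ⬝ᵥ v + (1 / 2) * ((A *ᵥ v) ⬝ᵥ (A *ᵥ v)) := by
  have h : gradH A b u ⬝ᵥ v = (A *ᵥ u - b) ⬝ᵥ (A *ᵥ v) := by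
    rw [gradH, mulVec_transpose, dotProduct_mulVec]
  have e : A *ᵥ (u + v) - b = (A *ᵥ u - b) + A *ᵥ v := by
    rw [mulVec_add]; abel
  rw [h, quadH, quadH, e, add_dotProduct, dotProduct_add, dotProduct_add,
    dotProduct_comm (A *ᵥ v) (A *ᵥ u - b)]
  ring

/-- The rescaled block sampling is unbiased: `E[U_I P v] = v`. -/
theorem sum_smul_blockUSet_mul_Pmat_mulVec {m d : ℕ} (blk : Fin m → Fin d)
    (Pi : Finset (Fin d) → ℝ) (hp : ∀ i, pblock Pi i ≠ 0) (v : Fin m → ℝ) :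
    ∑ I : Finset (Fin d), Pi I • ((blockUSet blk I * Pmat blk Pi) *ᵥ v) = v := by
  ext j
  have h : ∀ I : Finset (Fin d), (Pi I • ((blockUSet blk I * Pmat blk Pi) *ᵥ v)) j
      = (if blk j ∈ I then Pi I else 0) * ((pblock Pi (blk j))⁻¹ * v j) := by
    intro I
    rw [blockUSet, Pmat, diagonal_mul_diagonal, _root_.Pi.smul_apply, mulVec_diagonal, smul_eq_mul]
    split_ifs <;> ring
  rw [Finset.sum_apply, Finset.sum_congr rfl fun I _ => h I, ← Finset.sum_mul,
    ← Finset.sum_filter]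
  exact mul_inv_cancel_left₀ (hp (blk j)) (v j)

/-- `‖v‖_Σ² = E[‖A U_I P v‖²]`. -/
theorem mNormSq_SigmaMat {m q d : ℕ} (A : Matrix (Fin q) (Fin m) ℝ)
    (blk : Fin m → Fin d) (Pi : Finset (Fin d) → ℝ) (v : Fin m → ℝ) :
    mNormSq (SigmaMat A blk Pi) v
      = ∑ I : Finset (Fin d), Pi I *
          ((A *ᵥ ((blockUSet blk I * Pmat blk Pi) *ᵥ v))
            ⬝ᵥ (A *ᵥ ((blockUSet blk I * Pmat blk Pi) *ᵥ v))) := by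
  rw [mNormSq, SigmaMat, sum_mulVec, sum_dotProduct]
  refine Finset.sum_congr rfl fun I _ => ?_
  have hc : Pmat blk Pi * blockUSet blk I = blockUSet blk I * Pmat blk Pi := by
    rw [Pmat, blockUSet, diagonal_mul_diagonal, diagonal_mul_diagonal]
    simp only [mul_comm]
  have ht : (blockUSet blk I * Pmat blk Pi)ᵀ = blockUSet blk I * Pmat blk Pi := by
    rw [Pmat, blockUSet, diagonal_mul_diagonal, diagonal_transpose]
  rw [Matrix.mul_assoc _ (Pmat blk Pi), hc]
  generalize blockUSet blk I * Pmat blk Pi = D at ht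
  rw [smul_mulVec, smul_dotProduct, smul_eq_mul]
  congr 1
  rw [dotProduct_mulVec, dotProduct_mulVec, ← mulVec_transpose, ← mulVec_transpose, ht,
    mulVec_mulVec, mulVec_mulVec, mulVec_mulVec]
  simp only [Matrix.mul_assoc]

/-- If `Aᵀ(Ax* − b) = 0`, `z = (1−θ)s + θx` and `s⁺(I) = z + θ·U_I P (x̂ − x)`, then
`E[h(s⁺(I))] − h(x*) = θ⟨∇h(z), x̂ − x*⟩ + (1−θ)²(h(s) − h(x*)) − θ²(h(x) − h(x*))
+ (θ²/2)‖x̂ − x‖²_Σ`. -/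
theorem eso_identity_at_minimizer {m q d : ℕ}
    (A : Matrix (Fin q) (Fin m) ℝ) (b : Fin q → ℝ)
    (blk : Fin m → Fin d) (Pi : Finset (Fin d) → ℝ)
    (hPiNonneg : ∀ I, 0 ≤ Pi I) (hPiSum : ∑ I : Finset (Fin d), Pi I = 1)
    (hpPos : ∀ i, 0 < pblock Pi i)
    (xstar s x xhat : Fin m → ℝ)
    (hxstar : Aᵀ *ᵥ (A *ᵥ xstar - b) = 0)
    (θ : ℝ) (z : Fin m → ℝ) (hz : z = (1 - θ) • s + θ • x) :
    (∑ I : Finset (Fin d),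
        Pi I * quadH A b (z + θ • ((blockUSet blk I * Pmat blk Pi) *ᵥ (xhat - x))))
        - quadH A b xstar
      = θ * (gradH A b z ⬝ᵥ (xhat - xstar))
        + (1 - θ) ^ 2 * (quadH A b s - quadH A b xstar)
        - θ ^ 2 * (quadH A b x - quadH A b xstar)
        + (θ ^ 2 / 2) * mNormSq (SigmaMat A blk Pi) (xhat - x) := by
  have hsamp : ∑ I : Finset (Fin d),
        Pi I * quadH A b (z + θ • ((blockUSet blk I * Pmat blk Pi) *ᵥ (xhat - x)))
      = quadH A b z + θ * (gradH A b z ⬝ᵥ (xhat - x))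
        + (θ ^ 2 / 2) * mNormSq (SigmaMat A blk Pi) (xhat - x) := by
    have hlin := congrArg (fun w => gradH A b z ⬝ᵥ w)
      (sum_smul_blockUSet_mul_Pmat_mulVec blk Pi (fun i => (hpPos i).ne') (xhat - x))
    simp only [dotProduct_sum, dotProduct_smul, smul_eq_mul] at hlin
    rw [mNormSq_SigmaMat, ← hlin, Finset.mul_sum, Finset.mul_sum,
      ← one_mul (quadH A b z), ← hPiSum, Finset.sum_mul, ← Finset.sum_add_distrib,
      ← Finset.sum_add_distrib]
    refine Finset.sum_congr rfl fun I _ => ?_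
    simp only [quadH_add, mulVec_smul, dotProduct_smul, smul_dotProduct, smul_eq_mul]
    ring
  have hmin : ∀ v, quadH A b (xstar + v)
      = quadH A b xstar + (1 / 2) * ((A *ᵥ v) ⬝ᵥ (A *ᵥ v)) := by
    intro v
    rw [quadH_add, gradH, hxstar, zero_dotProduct, add_zero]
  obtain ⟨a, rfl⟩ : ∃ a, s = xstar + a := ⟨s - xstar, by abel⟩
  obtain ⟨c, rfl⟩ : ∃ c, x = xstar + c := ⟨x - xstar, by abel⟩
  have hz' : z = xstar + ((1 - θ) • a + θ • c) := by
    rw [hz]; module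
  have hgrad : gradH A b z ⬝ᵥ c
      = (1 - θ) * ((A *ᵥ a) ⬝ᵥ (A *ᵥ c)) + θ * ((A *ᵥ c) ⬝ᵥ (A *ᵥ c)) := by
    have e : A *ᵥ z - b = (A *ᵥ xstar - b) + ((1 - θ) • (A *ᵥ a) + θ • (A *ᵥ c)) := by
      rw [hz', mulVec_add, mulVec_add, mulVec_smul, mulVec_smul]; abel
    rw [gradH, e, mulVec_add, hxstar, zero_add, mulVec_transpose, ← dotProduct_mulVec,
      add_dotProduct, smul_dotProduct, smul_dotProduct, smul_eq_mul, smul_eq_mul]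
  have hsplit : gradH A b z ⬝ᵥ (xhat - (xstar + c))
      = gradH A b z ⬝ᵥ (xhat - xstar) - gradH A b z ⬝ᵥ c := by
    rw [← dotProduct_sub, sub_sub]
  have hzval : quadH A b z = quadH A b xstar + (1 / 2) *
      ((1 - θ) ^ 2 * ((A *ᵥ a) ⬝ᵥ (A *ᵥ a)) + 2 * θ * (1 - θ) * ((A *ᵥ a) ⬝ᵥ (A *ᵥ c))
        + θ ^ 2 * ((A *ᵥ c) ⬝ᵥ (A *ᵥ c))) := by
    rw [hz', hmin]
    simp only [mulVec_add, mulVec_smul, add_dotProduct, dotProduct_add, smul_dotProduct,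
      dotProduct_smul, smul_eq_mul, dotProduct_comm (A *ᵥ c) (A *ᵥ a)]
    ring
  rw [hsamp, hsplit, hgrad, hzval, hmin, hmin]
  ring
end

section
/- Let k ≥ 1, let x⁰,…,x^k, x̂ ∈ ℝ^m, and let the next random iterate be x^{k+1}(I) = x^k + U_I(x̂ − x^k). Let (γ_{k,l}) be the block-constant diagonal extrapolation coefficients: γ_{1,0} = Id − θ₀P, γ_{1,1} = θ₀P, and for k ≥ 1: γ_{k+1,l} = (1−θ_k)γ_{k,l} for l = 0,…,k−1, γ_{k+1,k} = (1−θ_k)θ_{k−1}P − θ_k(P − Id), γ_{k+1,k+1} = θ_k P. For a point u ∈ ℝ^m write Φᵛ(u) = (Φ_1(u_1),…,Φ_d(u_d)) ∈ ℝ^d, where u_i is the i-th block of u, and define Φ̂^k = Σ_{l=0}^{k} 1ᵀ γ̄_{k,l} Φᵛ(x^l), where γ̄_{k,l} ∈ ℝ^{d×d} is the diagonal matrix whose i-th entry is the common value of γ_{k,l} on block i and 1 = (1,…,1) ∈ ℝ^d. Then E_{I∼Π}[ Φ̂^{k+1} ] = (1−θ_k)·Φ̂^k + θ_k·Φ(x̂),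 where Φ̂^{k+1} is computed from x⁰,…,x^k, x^{k+1}(I) and Φ(u) = Σ_{i=1}^d Φ_i(u_i). -/
open Matrix

theorem sum_mul_ite_mem {d : ℕ} (Pi : Finset (Fin d) → ℝ)
    (hPiSum : ∑ I : Finset (Fin d), Pi I = 1) (i : Fin d) (a b : ℝ) :
    ∑ I : Finset (Fin d), Pi I * (if i ∈ I then a else b)
      = pblock Pi i * a + (1 - pblock Pi i) * b := by
  have hp : pblock Pi i = ∑ I : Finset (Fin d), if i ∈ I then Pi I else 0 :=
    Finset.sum_filter _ _
  rw [← hPiSum, hp, ← Finset.sum_sub_distrib, Finset.sum_mul, Finset.sum_mul,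
    ← Finset.sum_add_distrib]
  refine Finset.sum_congr rfl fun I _ => ?_
  split_ifs <;> ring

/-- A partial block update replaces exactly the blocks in `I`. -/
theorem block_update_apply {m d : ℕ} (blk : Fin m → Fin d) (I : Finset (Fin d))
    (u v : Fin m → ℝ) (j : Fin m) :
    (u + blockUSet blk I *ᵥ (v - u)) j = if blk j ∈ I then v j else u j := by
  simp only [blockUSet, Pi.add_apply, Matrix.mulVec_diagonal, Pi.sub_apply]
  split_ifs <;> ring

/-- Expected value of a block function after a random partial block update. -/
theorem expected_block_update {m d : ℕ} (blk : Fin m → Fin d) (Pi : Finset (Fin d) → ℝ)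
    (hPiSum : ∑ I : Finset (Fin d), Pi I = 1) (i : Fin d)
    (f : ({j : Fin m // blk j = i} → ℝ) → ℝ) (u v : Fin m → ℝ) :
    ∑ I : Finset (Fin d), Pi I * f (fun j => (u + blockUSet blk I *ᵥ (v - u)) j.1)
      = pblock Pi i * f (fun j => v j.1) + (1 - pblock Pi i) * f (fun j => u j.1) := by
  rw [← sum_mul_ite_mem Pi hPiSum]
  refine Finset.sum_congr rfl fun I _ => ?_
  congr 1
  rw [← apply_ite f]
  congr 1
  funext j
  rw [block_update_apply, j.2]
  split_ifs <;> rfl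

/-- Expectation of the extrapolated separable value `Φ̂^{k+1}`:
`E[Φ̂^{k+1}] = (1−θ_k)Φ̂^k + θ_k Φ(x̂)`, where `Φ̂^k = Σ_{l=0}^k 1ᵀ γ̄_{k,l} Φᵛ(x^l)`,
the `γ̄_{k,l} = diag(gb k l i)` being the (block-constant) extrapolation coefficients and
the next random iterate being `x^{k+1}(I) = x^k + U_I(x̂ − x^k)`. -/
theorem expected_extrapolated_value {m d : ℕ}
    (blk : Fin m → Fin d) (Pi : Finset (Fin d) → ℝ)
    (hPiNonneg : ∀ I, 0 ≤ Pi I) (hPiSum : ∑ I : Finset (Fin d), Pi I = 1)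
    (hpPos : ∀ i, 0 < pblock Pi i)
    (Φ : (i : Fin d) → ({j : Fin m // blk j = i} → ℝ) → ℝ)
    (θ : ℕ → ℝ)
    (gb : ℕ → ℕ → Fin d → ℝ)
    (hgb10 : ∀ i, gb 1 0 i = 1 - θ 0 * (pblock Pi i)⁻¹)
    (hgb11 : ∀ i, gb 1 1 i = θ 0 * (pblock Pi i)⁻¹)
    (hgbrec : ∀ k, 1 ≤ k → ∀ l, l ≤ k - 1 → ∀ i,
      gb (k + 1) l i = (1 - θ k) * gb k l i)
    (hgbk : ∀ k, 1 ≤ k → ∀ i,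
      gb (k + 1) k i
        = (1 - θ k) * θ (k - 1) * (pblock Pi i)⁻¹ - θ k * ((pblock Pi i)⁻¹ - 1))
    (hgbkk : ∀ k, 1 ≤ k → ∀ i, gb (k + 1) (k + 1) i = θ k * (pblock Pi i)⁻¹)
    (k : ℕ) (hk : 1 ≤ k)
    (x : ℕ → Fin m → ℝ) (xhat : Fin m → ℝ) :
    ∑ I : Finset (Fin d), Pi I *
        (∑ l ∈ Finset.range (k + 2), ∑ i : Fin d,
          gb (k + 1) l i *
            Φ i (fun j =>
              (if l = k + 1 then x k + blockUSet blk I *ᵥ (xhat - x k) else x l) j.1))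
      = (1 - θ k) *
          (∑ l ∈ Finset.range (k + 1), ∑ i : Fin d, gb k l i * Φ i (fun j => x l j.1))
        + θ k * ∑ i : Fin d, Φ i (fun j => xhat j.1) := by
  have hdiag : ∀ i, gb k k i = θ (k - 1) * (pblock Pi i)⁻¹ := by
    intro i
    obtain rfl | ⟨n, hn, rfl⟩ : k = 1 ∨ ∃ n, 1 ≤ n ∧ k = n + 1 := by
      rcases hk.eq_or_lt with h | h
      · exact Or.inl h.symm
      · exact Or.inr ⟨k - 1, by omega, by omega⟩
    · exact hgb11 i
    · exact hgbkk n hn i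
  have hpast : ∀ I : Finset (Fin d), ∀ l ∈ Finset.range k, ∑ i : Fin d, gb (k + 1) l i *
      Φ i (fun j =>
        (if l = k + 1 then x k + blockUSet blk I *ᵥ (xhat - x k) else x l) j.1)
      = (1 - θ k) * ∑ i : Fin d, gb k l i * Φ i (fun j => x l j.1) := by
    intro I l hl
    have hlk := Finset.mem_range.mp hl
    rw [Finset.mul_sum]
    refine Finset.sum_congr rfl fun i _ => ?_
    rw [if_neg (by omega), hgbrec k hk l (by omega) i, mul_assoc]
  have hnew : ∑ I : Finset (Fin d), Pi I * ∑ i : Fin d, gb (k + 1) (k + 1) i *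
      Φ i (fun j => (x k + blockUSet blk I *ᵥ (xhat - x k)) j.1)
      = ∑ i : Fin d, gb (k + 1) (k + 1) i * (pblock Pi i * Φ i (fun j => xhat j.1)
        + (1 - pblock Pi i) * Φ i (fun j => x k j.1)) := by
    simp_rw [← expected_block_update blk Pi hPiSum, Finset.mul_sum]
    rw [Finset.sum_comm]
    exact Finset.sum_congr rfl fun i _ => Finset.sum_congr rfl fun I _ => by ring
  simp_rw [Finset.sum_range_succ _ (k + 1), Finset.sum_range_succ _ k,
    fun I => Finset.sum_congr rfl (hpast I), if_neg (Nat.lt_succ_self k).ne, if_pos,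
    mul_add, Finset.sum_add_distrib, ← Finset.sum_mul, hPiSum, hnew, one_mul,
    ← Finset.mul_sum]
  rw [add_assoc, add_assoc]
  congr 1
  simp_rw [Finset.mul_sum, ← Finset.sum_add_distrib]
  refine Finset.sum_congr rfl fun i _ => ?_
  rw [hgbk k hk, hgbkk k hk, hdiag]
  have hp := (hpPos i).ne'
  field_simp
  ring
end
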